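/- Let s, t and m_1,…,m_t, c_1,…,c_t be positive integers with c_k ≤ s for each k, and let b = max_k m_k. In the polynomial ring Z = K[z_{i,j} : 1 ≤ i ≤ s, 1 ≤ j ≤ b], the ideal generated by all monomials ∏_{j=1}^{c_k} z_{i_j,e_j}, where 1 ≤ k ≤ t, 1 ≤ i_1 < i_2 < ⋯ < i_{c_k} ≤ s, 1 ≤ e_j ≤ m_k for each j, and e_1 + ⋯ + e_{c_k} ≤ m_k + c_k − 1, is a sparse symmetric shifted ideal; in particular, it has linear quotients. (This ideal is the Alexander dual of the polarization of the intersection ⋂_{k=1}^t I_{c_k}^{(m_k)} of symbolic powers of monomial star configuration ideals.) -/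

import Mathlib

open MvPolynomial

/-- The sparse squarefree monomial `z^μ = ∏_{i : μ i > 0} z_{i, μ i}`, where the variable
`z_{i,j}` (for `1 ≤ j ≤ b`) is represented by `X (i, j-1)`. -/
noncomputable def sparseMon (K : Type*) [Field K] (s b : ℕ) (μ : Fin s → ℕ) :
    MvPolynomial (Fin s × Fin b) K :=
  ∏ i : Fin s, ∏ j : Fin b, if μ i = (j : ℕ) + 1 then X (i, j) else 1

/-- `μ' ≤₀ μ`. -/
def leZero {s : ℕ} (μ' μ : Fin s → ℕ) : Prop :=
  ∀ i, μ' i ≤ μ i ∧ (μ' i = 0 ↔ μ i = 0)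

/-- The action of `σ ∈ S_s` on `Z`, sending `z_{i,j}` to `z_{σ i, j}`. -/
noncomputable def permMap (K : Type*) [Field K] (s b : ℕ) (σ : Equiv.Perm (Fin s)) :
    MvPolynomial (Fin s × Fin b) K →ₐ[K] MvPolynomial (Fin s × Fin b) K :=
  rename fun p => (σ p.1, p.2)

/-- `z^μ` is a minimal monomial generator of the monomial ideal `J`. -/
def IsMinSparseGen (K : Type*) [Field K] (s b : ℕ)
    (J : Ideal (MvPolynomial (Fin s × Fin b) K)) (μ : Fin s → ℕ) : Prop :=
  (∀ i, μ i ≤ b) ∧ sparseMon K s b μ ∈ J ∧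
    ∀ i, 0 < μ i → sparseMon K s b (Function.update μ i 0) ∉ J

/-- A proper monomial ideal `J` of `Z` is sparse symmetric shifted if (S-1) it is generated
by sparse squarefree monomials, (S-2) for every minimal monomial generator `z^μ` and every
`μ' ≤₀ μ` one has `z^{μ'} ∈ J`, and (S-3) `σ(J) = J` for every permutation `σ`. -/
def IsSSS (K : Type*) [Field K] (s b : ℕ)
    (J : Ideal (MvPolynomial (Fin s × Fin b) K)) : Prop :=
  J ≠ ⊤ ∧
  (∃ S : Set (Fin s → ℕ), (∀ μ ∈ S, ∀ i, μ i ≤ b) ∧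
      J = Ideal.span (sparseMon K s b '' S)) ∧
  (∀ μ : Fin s → ℕ, IsMinSparseGen K s b J μ →
      ∀ μ' : Fin s → ℕ, leZero μ' μ → sparseMon K s b μ' ∈ J) ∧
  (∀ σ : Equiv.Perm (Fin s), Ideal.map (permMap K s b σ) J = J)

/-- `f` is a minimal monomial generator of the monomial ideal `J`: it is a monomial
belonging to `J` such that no proper monomial divisor of it lies in `J`. -/
def IsMinMonGen (K : Type*) [Field K] (s b : ℕ)
    (J : Ideal (MvPolynomial (Fin s × Fin b) K)) (f : MvPolynomial (Fin s × Fin b) K) : Prop :=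
  (∃ m : (Fin s × Fin b) →₀ ℕ, f = monomial m 1) ∧ f ∈ J ∧
    ∀ g : MvPolynomial (Fin s × Fin b) K,
      (∃ m : (Fin s × Fin b) →₀ ℕ, g = monomial m 1) → g ∣ f → g ≠ f → g ∉ J

/-- A monomial ideal has linear quotients: its minimal monomial generators can be ordered
`u_0, …, u_{r-1}` so that each colon ideal `(⟨u_0, …, u_{i-1}⟩ : u_i)` (`i ≥ 1`) is
generated by a subset of the variables. -/
def HasLinearQuotients (K : Type*) [Field K] (s b : ℕ)
    (J : Ideal (MvPolynomial (Fin s × Fin b) K)) : Prop :=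
  ∃ (r : ℕ) (u : Fin r → MvPolynomial (Fin s × Fin b) K),
    Function.Injective u ∧
    (∀ i, IsMinMonGen K s b J (u i)) ∧
    (∀ f, IsMinMonGen K s b J f → ∃ i, u i = f) ∧
    ∀ i : Fin r, 0 < (i : ℕ) →
      ∃ V : Set (Fin s × Fin b),
        Submodule.colon (Ideal.span {g | ∃ j : Fin r, j < i ∧ g = u j})
          (Ideal.span {u i}) = Ideal.span (X '' V)

/-- The support degree: number of nonzero entries. -/
def suppdeg {s : ℕ} (ν : Fin s → ℕ) : ℕ := (Finset.univ.filter fun i => ν i ≠ 0).card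

/-- The weight: sum of the entries. -/
def wt {s : ℕ} (ν : Fin s → ℕ) : ℕ := ∑ i, ν i


/-- The exponent vector of the monomial `z^μ`. -/
noncomputable def sparseExp (s b : ℕ) (μ : Fin s → ℕ) : Fin s × Fin b →₀ ℕ :=
  Finsupp.equivFunOnFinite.symm fun p => if μ p.1 = (p.2 : ℕ) + 1 then 1 else 0

lemma sparseExp_apply {s b : ℕ} (μ : Fin s → ℕ) (p : Fin s × Fin b) :
    sparseExp s b μ p = if μ p.1 = (p.2 : ℕ) + 1 then 1 else 0 := rfl

lemma sparseMon_eq_monomial (K : Type*) [Field K] {s b : ℕ} (μ : Fin s → ℕ) :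
    sparseMon K s b μ = monomial (sparseExp s b μ) 1 := by
  rw [monomial_eq, Finsupp.prod_fintype _ _ (by simp), Fintype.prod_prod_type]
  simp only [sparseMon, map_one, one_mul, sparseExp_apply]
  refine Finset.prod_congr rfl fun i _ => Finset.prod_congr rfl fun j _ => ?_
  split_ifs <;> simp

/-- `ν` is obtained from `μ` by replacing some entries by zero. -/
def IsRestriction {s : ℕ} (ν μ : Fin s → ℕ) : Prop :=
  ∀ i, ν i = 0 ∨ ν i = μ i

namespace IsRestriction

lemma refl {s : ℕ} (μ : Fin s → ℕ) : IsRestriction μ μ := fun _ => Or.inr rfl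

lemma trans {s : ℕ} {ρ ν μ : Fin s → ℕ} (h : IsRestriction ρ ν) (h' : IsRestriction ν μ) :
    IsRestriction ρ μ := by
  intro i
  have := h i
  have := h' i
  grind

lemma antisymm {s : ℕ} {ν μ : Fin s → ℕ} (h : IsRestriction ν μ) (h' : IsRestriction μ ν) :
    ν = μ := by
  funext i
  have := h i
  have := h' i
  grind

end IsRestriction

lemma sparseExp_le_iff {s b : ℕ} {ν μ : Fin s → ℕ} (hν : ∀ i, ν i ≤ b) :
    sparseExp s b ν ≤ sparseExp s b μ ↔ IsRestriction ν μ := by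
  constructor
  · intro h i
    rcases Nat.eq_zero_or_pos (ν i) with h0 | h0
    · exact Or.inl h0
    · right
      have hi := hν i
      have := h (i, ⟨ν i - 1, by omega⟩)
      rw [sparseExp_apply, sparseExp_apply] at this
      grind
  · rintro h ⟨i, j⟩
    rw [sparseExp_apply, sparseExp_apply]
    have := h i
    grind

lemma sparseExp_injective {s b : ℕ} {ν μ : Fin s → ℕ} (hν : ∀ i, ν i ≤ b) (hμ : ∀ i, μ i ≤ b)
    (h : sparseExp s b ν = sparseExp s b μ) : ν = μ :=
  ((sparseExp_le_iff hν).1 h.le).antisymm ((sparseExp_le_iff hμ).1 h.ge)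

lemma suppdeg_eq_sum {s : ℕ} (ν : Fin s → ℕ) : suppdeg ν = ∑ i, if ν i = 0 then 0 else 1 := by
  rw [suppdeg, Finset.card_filter]
  exact Finset.sum_congr rfl fun i _ => by by_cases h : ν i = 0 <;> simp [h]

/-- A combination of the weight and the positions of the support, ordering the tuples first by
weight and then by the sum of the positions of the support. -/
def posWt {s : ℕ} (ν : Fin s → ℕ) : ℕ :=
  ∑ i, if ν i = 0 then 0 else ν i * (s * s + 1) + (i : ℕ)

lemma posWt_div {s : ℕ} (ν : Fin s → ℕ) : posWt ν / (s * s + 1) = wt ν := by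
  have h1 : posWt ν = wt ν * (s * s + 1) + ∑ i, if ν i = 0 then 0 else (i : ℕ) := by
    rw [posWt, wt, Finset.sum_mul, ← Finset.sum_add_distrib]
    exact Finset.sum_congr rfl fun i _ => by split_ifs with h <;> simp [h]
  have h2 : (∑ i, if ν i = 0 then 0 else (i : ℕ)) ≤ s * s := by
    calc _ ≤ ∑ _i : Fin s, s := Finset.sum_le_sum fun i _ => by split_ifs <;> omega
      _ = s * s := by simp
  rw [h1, mul_comm, Nat.mul_add_div (by omega), Nat.div_eq_of_lt (by omega), add_zero]

lemma wt_le_of_posWt_le {s : ℕ} {ν μ : Fin s → ℕ} (h : posWt ν ≤ posWt μ) : wt ν ≤ wt μ := by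
  rw [← posWt_div, ← posWt_div]
  exact Nat.div_le_div_right h

/-- The key by which the minimal generators are sorted. -/
def sortKey {s : ℕ} (ν : Fin s → ℕ) : ℕ ×ₗ ℕ := toLex (suppdeg ν, posWt ν)

namespace IsRestriction

lemma suppdeg_le {s : ℕ} {ν μ : Fin s → ℕ} (h : IsRestriction ν μ) : suppdeg ν ≤ suppdeg μ := by
  rw [suppdeg_eq_sum, suppdeg_eq_sum]
  refine Finset.sum_le_sum fun i _ => ?_
  have := h i
  grind

lemma suppdeg_lt {s : ℕ} {ν μ : Fin s → ℕ} (h : IsRestriction ν μ) (hne : ν ≠ μ) :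
    suppdeg ν < suppdeg μ := by
  obtain ⟨i, hi⟩ := Function.ne_iff.1 hne
  rw [suppdeg_eq_sum, suppdeg_eq_sum]
  refine Finset.sum_lt_sum (fun i _ => ?_) ⟨i, Finset.mem_univ i, ?_⟩ <;>
  · have := h i
    grind

lemma sortKey_le {s : ℕ} {ν μ : Fin s → ℕ} (h : IsRestriction ν μ) : sortKey ν ≤ sortKey μ := by
  by_cases hne : ν = μ
  · rw [hne]
  · exact (Prod.Lex.toLex_lt_toLex.2 (Or.inl (h.suppdeg_lt hne))).le

end IsRestriction

/-- `μ` is minimal, with respect to restriction, among the tuples satisfying `A`. -/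
def IsMinTuple {s : ℕ} (A : (Fin s → ℕ) → Prop) (μ : Fin s → ℕ) : Prop :=
  A μ ∧ ∀ ν, A ν → IsRestriction ν μ → ν = μ

lemma exists_isMinTuple {s : ℕ} {A : (Fin s → ℕ) → Prop} (μ : Fin s → ℕ) (hμ : A μ) :
    ∃ ν, IsMinTuple A ν ∧ IsRestriction ν μ := by
  induction hn : suppdeg μ using Nat.strong_induction_on generalizing μ with
  | _ n ih =>
    by_cases h : IsMinTuple A μ
    · exact ⟨μ, h, .refl μ⟩
    · simp only [IsMinTuple, hμ, true_and, not_forall] at h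
      obtain ⟨ρ, hρ, hR, hne⟩ := h
      obtain ⟨ν, hν, hνρ⟩ := ih _ (hn ▸ hR.suppdeg_lt hne) ρ hρ rfl
      exact ⟨ν, hν, hνρ.trans hR⟩

/-- Moving an entry of a tuple changes only two terms of a sum over its entries. -/
lemma sum_update_update {s : ℕ} (h : Fin s → ℕ → ℕ) (h0 : ∀ i, h i 0 = 0) (ν : Fin s → ℕ)
    (i j : Fin s) (v : ℕ) (hij : i = j ∨ ν i = 0) :
    ∑ l, h l (Function.update (Function.update ν j 0) i v l) + h j (ν j) =
      ∑ l, h l (ν l) + h i v := by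
  have key : ∀ (ρ : Fin s → ℕ) (i : Fin s) (v : ℕ),
      ∑ l, h l (Function.update ρ i v l) + h i (ρ i) = ∑ l, h l (ρ l) + h i v := by
    intro ρ i v
    rw [← Finset.add_sum_erase _ _ (Finset.mem_univ i),
      ← Finset.add_sum_erase _ (fun l => h l (ρ l)) (Finset.mem_univ i),
      Finset.sum_congr rfl (g := fun l => h l (ρ l))
        (fun l hl => by rw [Function.update_of_ne (Finset.ne_of_mem_erase hl)]),
      Function.update_self]
    ring
  have h1 := key (Function.update ν j 0) i v
  have h2 := key ν j 0
  have h3 : h i (Function.update ν j 0 i) = 0 := by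
    by_cases hj : i = j
    · rw [hj, Function.update_self, h0]
    · rw [Function.update_of_ne hj, hij.resolve_left hj, h0]
  rw [h0] at h2
  omega

/-- A comparison of sums over two finite sets, when each term indexed outside the common part of
the first set is smaller than each one outside the common part of the second. -/
lemma sum_le_sum_of_exchange {ι : Type*} [DecidableEq ι] {T U : Finset ι} {f g : ι → ℕ}
    (hcard : T.card = U.card) (hcommon : ∀ i ∈ T ∩ U, f i ≤ g i)
    (hdiff : ∀ j ∈ T \ U, ∀ i ∈ U \ T, f j < g i) :
    ∑ i ∈ T, f i ≤ ∑ i ∈ U, g i ∧ (∑ i ∈ T, f i = ∑ i ∈ U, g i → T = U ∧ ∀ i ∈ T, f i = g i) := by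
  have hT : ∑ i ∈ T, f i = ∑ i ∈ T ∩ U, f i + ∑ i ∈ T \ U, f i :=
    (Finset.sum_inter_add_sum_sdiff T U f).symm
  have hU : ∑ i ∈ U, g i = ∑ i ∈ T ∩ U, g i + ∑ i ∈ U \ T, g i := by
    rw [Finset.inter_comm, Finset.sum_inter_add_sum_sdiff]
  have h1 := Finset.sum_le_sum hcommon
  have hc : (T \ U).card = (U \ T).card := Finset.card_sdiff_comm hcard
  by_cases hne : (U \ T).Nonempty
  · have h2 : ∑ i ∈ T \ U, f i < ∑ i ∈ U \ T, g i := by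
      obtain ⟨i, hi, hmin⟩ := Finset.exists_min_image (U \ T) g hne
      have hne' : (T \ U).Nonempty := by rwa [← Finset.card_pos, hc, Finset.card_pos]
      calc ∑ j ∈ T \ U, f j < ∑ _j ∈ T \ U, g i :=
            Finset.sum_lt_sum_of_nonempty hne' fun j hj => hdiff j hj i hi
        _ = ∑ _j ∈ U \ T, g i := by rw [Finset.sum_const, Finset.sum_const, hc]
        _ ≤ ∑ i ∈ U \ T, g i := Finset.sum_le_sum hmin
    omega
  · have hUT : U ⊆ T := by simpa [Finset.sdiff_eq_empty_iff_subset] using hne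
    have hTU : T = U := (Finset.eq_of_subset_of_card_le hUT hcard.le).symm
    subst hTU
    simp only [Finset.inter_self] at hcommon
    exact ⟨Finset.sum_le_sum hcommon, fun h => ⟨rfl, (Finset.sum_eq_sum_iff_of_le hcommon).1 h⟩⟩

/-- Exchange property of the tuples satisfying a condition on support degree and weight that is
inherited by smaller weights. -/
lemma exists_exchange {s : ℕ} {P : ℕ → ℕ → Prop} (hP : ∀ d w w', w' ≤ w → P d w → P d w')
    {μ ν : Fin s → ℕ} (hμ : P (suppdeg μ) (wt μ))
    (hν : IsMinTuple (fun ρ => P (suppdeg ρ) (wt ρ)) ν) (hne : μ ≠ ν)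
    (hkey : sortKey μ ≤ sortKey ν) :
    ∃ i ρ, μ i ≠ 0 ∧ μ i ≠ ν i ∧ P (suppdeg ρ) (wt ρ) ∧ sortKey ρ < sortKey ν ∧
      ρ i = μ i ∧ ∀ l, l ≠ i → ρ l = 0 ∨ ρ l = ν l := by
  set f : (Fin s → ℕ) → Fin s → ℕ := fun ρ i => ρ i * (s * s + 1) + (i : ℕ) with hf
  by_cases hex : ∃ i j, μ i ≠ 0 ∧ ν j ≠ 0 ∧ (i = j ∨ ν i = 0) ∧ f μ i < f ν j
  · obtain ⟨i, j, hi, hj, hij, hlt⟩ := hex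
    set ρ := Function.update (Function.update ν j 0) i (μ i) with hρ
    have hd : suppdeg ρ = suppdeg ν := by
      have := sum_update_update (fun _ v => if v = 0 then 0 else 1) (by simp) ν i j (μ i) hij
      simp only [← hρ, ← suppdeg_eq_sum, if_neg hi, if_neg hj] at this
      omega
    have hw : posWt ρ < posWt ν := by
      have := sum_update_update (fun l v => if v = 0 then 0 else v * (s * s + 1) + (l : ℕ))
        (by simp) ν i j (μ i) hij
      simp only [← hρ, if_neg hi, if_neg hj] at this
      simp only [hf] at hlt
      rw [posWt, posWt]
      omega
    refine ⟨i, ρ, hi, ?_, ?_, ?_, by simp [hρ], fun l hl => ?_⟩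
    · rintro h
      rcases hij with rfl | hij
      · simp [hf, h] at hlt
      · exact hi (h.trans hij)
    · rw [hd]
      exact hP _ _ _ (wt_le_of_posWt_le hw.le) hν.1
    · exact Prod.Lex.toLex_lt_toLex.2 (Or.inr ⟨hd, hw⟩)
    · rw [hρ, Function.update_of_ne hl]
      by_cases hlj : l = j
      · simp [hlj]
      · simp [hlj]
  · exfalso
    push Not at hex
    set U := Finset.univ.filter fun i => μ i ≠ 0 with hU
    set V := Finset.univ.filter fun i => ν i ≠ 0 with hV
    have hUd : U.card = suppdeg μ := rfl
    have hVd : V.card = suppdeg ν := rfl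
    have hkey' : suppdeg μ < suppdeg ν ∨ suppdeg μ = suppdeg ν ∧ posWt μ ≤ posWt ν :=
      Prod.Lex.toLex_le_toLex.1 hkey
    obtain ⟨T, hT1, hT2, hTc⟩ := Finset.exists_subsuperset_card_eq
      (Finset.inter_subset_right : U ∩ V ⊆ V) (Finset.card_le_card Finset.inter_subset_left)
      (show U.card ≤ V.card by omega)
    have hsum := sum_le_sum_of_exchange (f := f ν) (g := f μ) hTc
      (fun i hi => by
        have := @hT2 i
        exact hex i i (by grind) (by grind) (Or.inl rfl))
      (fun j hj i hi => by
        have h1 := @hT2 j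
        have h2 := @hT1 i
        have h3 : ν i = 0 := by grind
        have h4 : j ≠ i := by grind
        refine lt_of_le_of_ne (hex i j (by grind) (by grind) (Or.inr h3)) fun h => h4 ?_
        have hj' : (j : ℕ) < s * s + 1 := by nlinarith [j.2]
        have hi' : (i : ℕ) < s * s + 1 := by nlinarith [i.2]
        have := congrArg (· % (s * s + 1)) h
        simp only [hf, Nat.mul_add_mod_self_right, Nat.mod_eq_of_lt hj', Nat.mod_eq_of_lt hi']
          at this
        exact Fin.ext this)
    have hsum_posWt : ∀ ρ : Fin s → ℕ, posWt ρ = ∑ i with ρ i ≠ 0, f ρ i := fun ρ => by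
      rw [posWt, Finset.sum_filter]
      exact Finset.sum_congr rfl fun i _ => by simp [hf]
    set ρ : Fin s → ℕ := fun i => if i ∈ T then ν i else 0 with hρ
    have hsupp : (Finset.univ.filter fun i => ρ i ≠ 0) = T := by
      ext i
      have := @hT2 i
      grind
    have hρw : posWt ρ = ∑ i ∈ T, f ν i := by
      rw [hsum_posWt, hsupp]
      exact Finset.sum_congr rfl fun i hi => by simp [hf, hρ, hi]
    have hρd : suppdeg ρ = suppdeg μ := by rw [suppdeg, hsupp, hTc, hUd]
    have hρν : ρ = ν := by
      refine hν.2 ρ ?_ fun i => by grind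
      show P (suppdeg ρ) (wt ρ)
      rw [hρd]
      refine hP _ _ _ (wt_le_of_posWt_le ?_) hμ
      rw [hρw, hsum_posWt μ]
      exact hsum.1
    rw [hρν] at hρw hρd
    have hle : posWt μ ≤ posWt ν := by omega
    obtain ⟨hTU, hfeq⟩ := hsum.2 (le_antisymm hsum.1 (by rwa [← hρw, ← hsum_posWt μ]))
    refine hne (funext fun i => ?_)
    by_cases hi : i ∈ T
    · have := hfeq i hi
      simp only [hf, add_left_inj] at this
      exact (Nat.eq_of_mul_eq_mul_right (by omega) this).symm
    · have h1 : ν i = 0 := by rw [← hρν]; simp [hρ, hi]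
      have h2 : μ i = 0 := by
        rw [hTU] at hi
        simpa [hU] using hi
      rw [h1, h2]

lemma add_suppdeg_le_wt_add_one {s : ℕ} (ν : Fin s → ℕ) (i : Fin s) :
    ν i + suppdeg ν ≤ wt ν + 1 := by
  rw [suppdeg_eq_sum, wt, ← Finset.add_sum_erase _ _ (Finset.mem_univ i),
    ← Finset.add_sum_erase _ ν (Finset.mem_univ i)]
  have h : (∑ l ∈ Finset.univ.erase i, if ν l = 0 then 0 else 1) ≤
      ∑ l ∈ Finset.univ.erase i, ν l :=
    Finset.sum_le_sum fun l _ => by split_ifs <;> omega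
  split_ifs <;> omega

section Ideals

variable {K : Type*} [Field K] {s b : ℕ}

lemma mem_span_sparseMon_image {S : Set (Fin s → ℕ)} {f : MvPolynomial (Fin s × Fin b) K} :
    f ∈ Ideal.span (sparseMon K s b '' S) ↔
      ∀ x ∈ f.support, ∃ μ ∈ S, sparseExp s b μ ≤ x := by
  have h : sparseMon K s b '' S = (fun x => monomial x (1 : K)) '' (sparseExp s b '' S) := by
    rw [Set.image_image]
    exact Set.image_congr fun μ _ => sparseMon_eq_monomial K μ
  rw [h, mem_ideal_span_monomial_image]
  simp

lemma monomial_mem_span_sparseMon_image {S : Set (Fin s → ℕ)} {x : Fin s × Fin b →₀ ℕ} :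
    monomial x (1 : K) ∈ Ideal.span (sparseMon K s b '' S) ↔
      ∃ μ ∈ S, sparseExp s b μ ≤ x := by
  rw [mem_span_sparseMon_image]
  simp

lemma permMap_sparseMon (σ : Equiv.Perm (Fin s)) (μ : Fin s → ℕ) :
    permMap K s b σ (sparseMon K s b μ) = sparseMon K s b (μ ∘ σ.symm) := by
  simp only [sparseMon, permMap, map_prod]
  conv_rhs => rw [← Equiv.prod_comp σ]
  refine Finset.prod_congr rfl fun i _ => Finset.prod_congr rfl fun j _ => ?_
  simp [apply_ite (rename fun p : Fin s × Fin b => (σ p.1, p.2))]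

/-- The ideal generated by the sparse monomials of the tuples whose support degree and weight
satisfy `P` is sparse symmetric shifted. -/
lemma isSSS_span {P : ℕ → ℕ → Prop} (hP : ∀ d w w', w' ≤ w → P d w → P d w')
    (hb : ∀ μ : Fin s → ℕ, P (suppdeg μ) (wt μ) → ∀ i, μ i ≤ b) (h0 : ∀ w, ¬ P 0 w) :
    IsSSS K s b (Ideal.span (sparseMon K s b '' {μ | P (suppdeg μ) (wt μ)})) := by
  refine ⟨?_, ⟨_, hb, rfl⟩, ?_, ?_⟩
  · rw [Ideal.ne_top_iff_one, ← map_one C, C_apply, monomial_mem_span_sparseMon_image]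
    rintro ⟨μ, hμ, hle⟩
    have hR : IsRestriction μ 0 := by
      refine (sparseExp_le_iff (hb μ hμ)).1 (hle.trans ?_)
      intro p
      simp
    have hμ0 : μ = 0 := funext fun i => by simpa using hR i
    refine h0 (wt μ) ?_
    have hd : suppdeg μ = 0 := by simp [hμ0, suppdeg]
    simpa only [Set.mem_ofPred_eq, hd] using hμ
  · rintro μ ⟨-, hμ, -⟩ μ' hle
    rw [sparseMon_eq_monomial, monomial_mem_span_sparseMon_image] at hμ ⊢
    obtain ⟨ρ, hρ, hρμ⟩ := hμ
    rw [sparseExp_le_iff (hb ρ hρ)] at hρμ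
    set ρ' : Fin s → ℕ := fun i => if ρ i = 0 then 0 else μ' i with hρ'
    have h1 : ∀ i, ρ' i ≤ ρ i ∧ (ρ' i = 0 ↔ ρ i = 0) := fun i => by
      have := hρμ i
      have := hle i
      grind
    have hd : suppdeg ρ' = suppdeg ρ := by simp only [suppdeg, ne_eq, h1]
    have hA : P (suppdeg ρ') (wt ρ') := by
      rw [hd]
      exact hP _ _ _ (Finset.sum_le_sum fun i _ => (h1 i).1) hρ
    refine ⟨ρ', hA, (sparseExp_le_iff (hb ρ' hA)).2 fun i => ?_⟩
    by_cases h : ρ i = 0 <;> simp [hρ', h]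
  · intro σ
    rw [Ideal.map_span, Set.image_image]
    simp only [permMap_sparseMon]
    congr 1
    have hperm : ∀ (τ : Equiv.Perm (Fin s)) (μ : Fin s → ℕ),
        P (suppdeg μ) (wt μ) → P (suppdeg (μ ∘ τ)) (wt (μ ∘ τ)) := by
      intro τ μ h
      have hd : suppdeg (μ ∘ τ) = suppdeg μ := by
        rw [suppdeg_eq_sum, suppdeg_eq_sum]
        exact Equiv.sum_comp τ fun i => if μ i = 0 then 0 else 1
      have hw : wt (μ ∘ τ) = wt μ := Equiv.sum_comp τ μ
      rwa [hd, hw]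
    ext g
    constructor
    · rintro ⟨μ, hμ, rfl⟩
      exact ⟨_, hperm σ.symm μ hμ, rfl⟩
    · rintro ⟨μ, hμ, rfl⟩
      exact ⟨_, hperm σ μ hμ, by simp [Function.comp_assoc]⟩

lemma isMinMonGen_span_iff {A : (Fin s → ℕ) → Prop} (hb : ∀ μ, A μ → ∀ i, μ i ≤ b)
    (f : MvPolynomial (Fin s × Fin b) K) :
    IsMinMonGen K s b (Ideal.span (sparseMon K s b '' {μ | A μ})) f ↔
      ∃ μ, IsMinTuple A μ ∧ f = sparseMon K s b μ := by
  constructor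
  · rintro ⟨⟨x, rfl⟩, hmem, hmin⟩
    obtain ⟨μ, hμ, hle⟩ := monomial_mem_span_sparseMon_image.1 hmem
    obtain ⟨ν, hν, hνμ⟩ := exists_isMinTuple μ hμ
    refine ⟨ν, hν, ?_⟩
    rw [sparseMon_eq_monomial]
    by_contra hne
    refine hmin _ ⟨_, rfl⟩ ?_ (Ne.symm hne)
      (monomial_mem_span_sparseMon_image.2 ⟨ν, hν.1, le_rfl⟩)
    exact monomial_dvd_monomial.2
      ⟨Or.inr (((sparseExp_le_iff (hb ν hν.1)).2 hνμ).trans hle), dvd_rfl⟩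
  · rintro ⟨μ, hμ, rfl⟩
    refine ⟨⟨_, sparseMon_eq_monomial K μ⟩, Ideal.subset_span ⟨μ, hμ.1, rfl⟩, ?_⟩
    rintro _ ⟨x, rfl⟩ hdvd hne hmem
    obtain ⟨ν, hν, hle⟩ := monomial_mem_span_sparseMon_image.1 hmem
    rw [sparseMon_eq_monomial, monomial_dvd_monomial] at hdvd
    have hx : x ≤ sparseExp s b μ := hdvd.1.resolve_left one_ne_zero
    have hνμ : ν = μ := hμ.2 ν hν ((sparseExp_le_iff (hb ν hν)).1 (hle.trans hx))
    subst hνμ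
    exact hne (by rw [sparseMon_eq_monomial, le_antisymm hx hle])

/-- The colon ideal of an ideal generated by sparse monomials by a sparse monomial `z^ν` is
generated by variables if for each generator `z^μ` some variable dividing `z^μ` but not `z^ν`
multiplies `z^ν` into the ideal. -/
lemma colon_span_sparseMon_eq {S : Set (Fin s → ℕ)} {ν : Fin s → ℕ}
    (h : ∀ μ ∈ S, ∃ p, sparseExp s b μ p ≠ 0 ∧ sparseExp s b ν p = 0 ∧
      ∃ ρ ∈ S, sparseExp s b ρ ≤ sparseExp s b ν + Finsupp.single p 1) :
    ∃ V : Set (Fin s × Fin b),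
      Submodule.colon (Ideal.span (sparseMon K s b '' S))
        (Ideal.span {sparseMon K s b ν} : Ideal (MvPolynomial (Fin s × Fin b) K)) =
          Ideal.span (X '' V) := by
  have hcolon : ∀ f, f ∈ Submodule.colon (Ideal.span (sparseMon K s b '' S))
      (Ideal.span {sparseMon K s b ν} : Ideal (MvPolynomial (Fin s × Fin b) K)) ↔
        f * monomial (sparseExp s b ν) 1 ∈ Ideal.span (sparseMon K s b '' S) := by
    intro f
    rw [← sparseMon_eq_monomial, Submodule.mem_colon]
    constructor
    · exact fun hf => hf _ (Ideal.mem_span_singleton_self _)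
    · intro hf g hg
      obtain ⟨a, rfl⟩ := Ideal.mem_span_singleton'.1 hg
      rw [smul_eq_mul, mul_left_comm]
      exact Ideal.mul_mem_left _ _ hf
  have hX : ∀ p, (X p * monomial (sparseExp s b ν) 1 : MvPolynomial (Fin s × Fin b) K) ∈
      Ideal.span (sparseMon K s b '' S) ↔
        ∃ ρ ∈ S, sparseExp s b ρ ≤ sparseExp s b ν + Finsupp.single p 1 := by
    intro p
    rw [X, monomial_mul, one_mul, monomial_mem_span_sparseMon_image, add_comm]
  refine ⟨{p | ∃ ρ ∈ S, sparseExp s b ρ ≤ sparseExp s b ν + Finsupp.single p 1},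
    le_antisymm (fun f hf => ?_) (Ideal.span_le.2 ?_)⟩
  · rw [hcolon, mem_span_sparseMon_image] at hf
    rw [mem_ideal_span_X_image]
    intro x hx
    obtain ⟨μ, hμ, hle⟩ := hf (x + sparseExp s b ν) (by
      rw [mem_support_iff, coeff_mul_monomial, mul_one]
      exact mem_support_iff.1 hx)
    obtain ⟨p, hp, hp0, hρ⟩ := h μ hμ
    refine ⟨p, hρ, fun hxp => hp ?_⟩
    simpa [hxp, hp0] using hle p
  · rintro _ ⟨p, hp, rfl⟩
    exact (hcolon _).2 ((hX p).2 hp)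

lemma hasLinearQuotients_span {P : ℕ → ℕ → Prop} (hP : ∀ d w w', w' ≤ w → P d w → P d w')
    (hb : ∀ μ : Fin s → ℕ, P (suppdeg μ) (wt μ) → ∀ i, μ i ≤ b) :
    HasLinearQuotients K s b
      (Ideal.span (sparseMon K s b '' {μ | P (suppdeg μ) (wt μ)})) := by
  set A : (Fin s → ℕ) → Prop := fun μ => P (suppdeg μ) (wt μ)
  have hfin : {μ | IsMinTuple A μ}.Finite :=
    (Set.finite_Iic (fun _ : Fin s => b)).subset fun μ hμ => hb μ hμ.1
  obtain ⟨r, g, hginj, hgran, hgmono⟩ : ∃ (r : ℕ) (g : Fin r → Fin s → ℕ),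
      Function.Injective g ∧ (∀ μ, IsMinTuple A μ ↔ ∃ i, g i = μ) ∧
        Monotone fun i => sortKey (g i) := by
    set e := hfin.toFinset.equivFin.symm
    set κ := fun i => sortKey (e i : Fin s → ℕ)
    refine ⟨_, fun i => e (Tuple.sort κ i), ?_, fun μ => ⟨fun hμ => ?_, ?_⟩,
      Tuple.monotone_sort κ⟩
    · exact Subtype.val_injective.comp (e.injective.comp (Tuple.sort κ).injective)
    · exact ⟨(Tuple.sort κ).symm (e.symm ⟨μ, by simpa using hμ⟩), by simp⟩
    · rintro ⟨i, rfl⟩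
      exact hfin.mem_toFinset.1 (e (Tuple.sort κ i)).2
  have hgmin : ∀ i, IsMinTuple A (g i) := fun i => (hgran _).2 ⟨i, rfl⟩
  refine ⟨r, fun i => sparseMon K s b (g i), fun i j hij => hginj ?_, fun i => ?_, fun f hf => ?_,
    fun i _ => ?_⟩
  · simp only [sparseMon_eq_monomial] at hij
    exact sparseExp_injective (hb _ (hgmin i).1) (hb _ (hgmin j).1)
      (monomial_left_injective one_ne_zero hij)
  · exact (isMinMonGen_span_iff hb _).2 ⟨_, hgmin i, rfl⟩
  · obtain ⟨μ, hμ, rfl⟩ := (isMinMonGen_span_iff hb _).1 hf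
    obtain ⟨i, rfl⟩ := (hgran μ).1 hμ
    exact ⟨i, rfl⟩
  · have himage : {f | ∃ j : Fin r, j < i ∧ f = sparseMon K s b (g j)} =
        sparseMon K s b '' (g '' Set.Iio i) := by
      ext f
      simp [eq_comm]
    rw [himage]
    refine colon_span_sparseMon_eq ?_
    rintro _ ⟨j, hj, rfl⟩
    obtain ⟨l, ρ, hl, hne, hρ, hlt, hρl, hρo⟩ := exists_exchange hP (hgmin j).1 (hgmin i)
      (hginj.ne (ne_of_lt hj)) (hgmono (le_of_lt hj))
    obtain ⟨ρ', hρ', hR⟩ := exists_isMinTuple (A := A) ρ hρ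
    have hjl := hb _ (hgmin j).1 l
    refine ⟨(l, ⟨g j l - 1, by omega⟩), ?_, ?_, ρ', ?_, ?_⟩
    · rw [sparseExp_apply]
      grind
    · rw [sparseExp_apply]
      grind
    · obtain ⟨k, rfl⟩ := (hgran ρ').1 hρ'
      exact ⟨k, lt_of_not_ge fun hik => (hR.sortKey_le.trans_lt hlt).not_ge (hgmono hik), rfl⟩
    · refine ((sparseExp_le_iff (hb _ hρ'.1)).2 hR).trans ?_
      rintro ⟨l', q⟩
      rw [Finsupp.add_apply, sparseExp_apply, sparseExp_apply, Finsupp.single_apply]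
      by_cases hl' : l' = l
      · subst hl'
        simp only [Prod.mk.injEq, true_and, Fin.ext_iff, hρl]
        grind
      · have := hρo l' hl'
        grind

end Ideals

/-- The Alexander dual of the polarization of an intersection
`⋂ₖ I_{c_k}^{(m_k)}` of symbolic powers of monomial star configuration ideals, i.e. the ideal
generated by all monomials `∏_{j=1}^{c_k} z_{i_j, e_j}` with `i_1 < ⋯ < i_{c_k}`,
`1 ≤ e_j ≤ m_k` and `e_1 + ⋯ + e_{c_k} ≤ m_k + c_k - 1`, is sparse symmetric shifted;
in particular it has linear quotients. -/
theorem alexanderDual_polarization_isSSS {K : Type*} [Field K] (s t : ℕ)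
    (hs : 0 < s) (ht : 0 < t)
    (m c : Fin t → ℕ) (hm : ∀ k, 0 < m k) (hc : ∀ k, 0 < c k) (hcs : ∀ k, c k ≤ s)
    (b : ℕ) (hb : b = Finset.univ.sup m)
    (J : Ideal (MvPolynomial (Fin s × Fin b) K))
    (hJ : J = Ideal.span {g | ∃ (k : Fin t) (μ : Fin s → ℕ),
      suppdeg μ = c k ∧ (∀ i, μ i ≤ m k) ∧ wt μ ≤ m k + c k - 1 ∧
      g = sparseMon K s b μ}) :
    IsSSS K s b J ∧ HasLinearQuotients K s b J := by
  set P : ℕ → ℕ → Prop := fun d w => ∃ k, d = c k ∧ w ≤ m k + c k - 1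
  have hmk : ∀ (k : Fin t) (μ : Fin s → ℕ), suppdeg μ = c k → wt μ ≤ m k + c k - 1 →
      ∀ i, μ i ≤ m k := by
    intro k μ hd hw i
    have := add_suppdeg_le_wt_add_one μ i
    have := hc k
    omega
  have hP : ∀ d w w', w' ≤ w → P d w → P d w' := by
    rintro d w w' hw ⟨k, hd, hk⟩
    exact ⟨k, hd, hw.trans hk⟩
  have hbound : ∀ μ : Fin s → ℕ, P (suppdeg μ) (wt μ) → ∀ i, μ i ≤ b := by
    rintro μ ⟨k, hd, hw⟩ i
    rw [hb]
    exact (hmk k μ hd hw i).trans (Finset.le_sup (Finset.mem_univ k))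
  have h0 : ∀ w, ¬ P 0 w := by
    rintro w ⟨k, hk, -⟩
    exact (hc k).ne hk
  have hgen : {g | ∃ (k : Fin t) (μ : Fin s → ℕ), suppdeg μ = c k ∧ (∀ i, μ i ≤ m k) ∧
      wt μ ≤ m k + c k - 1 ∧ g = sparseMon K s b μ} =
        sparseMon K s b '' {μ | P (suppdeg μ) (wt μ)} := by
    ext g
    constructor
    · rintro ⟨k, μ, hd, -, hw, rfl⟩
      exact ⟨μ, ⟨k, hd, hw⟩, rfl⟩
    · rintro ⟨μ, ⟨k, hd, hw⟩, rfl⟩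
      exact ⟨k, μ, hd, hmk k μ hd hw, hw, rfl⟩
  rw [hJ, hgen]
  exact ⟨isSSS_span hP hbound h0, hasLinearQuotients_span hP hbound⟩
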